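/- Fix real parameters κ_1 < κ_2 < ⋯ < κ_n such that the sums Σ_{i ∈ J} κ_i over k-element subsets J of {1, …, n} are pairwise distinct. Let A be a real k×n matrix of rank k all of whose k×k minors are nonnegative, let M = { J : Δ_J(A) > 0 }, and let J* be the lexicographically maximal element of M, where k-subsets are compared by listing their elements in decreasing order and comparing lexicographically. For a k-subset J = {j_1 < ⋯ < j_k} define E_J(x,y,t) = ∏_{1 ≤ l < m ≤ k} (κ_{j_m} − κ_{j_l}) · exp( Σ_{i ∈ J} (κ_i x + κ_i² y + κ_i³ t) ). Then for every y, t ∈ ℝ there exists x_0 ∈ ℝ such that for all x > x_0 and every J ∈ M with J ≠ J*, Δ_{J*}(A) E_{J*}(x,y,t) > Δ_J(A) E_J(x,y,t); i.e., for x sufficiently large the term indexed by the lexicographically maximal nonzero Plücker coordinate dominates the τ-function. -/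

import Mathlib

open scoped BigOperators

/-- The maximal minor of a `k × n` matrix `A` on the column set `I` (columns taken in
increasing order); defined to be `0` if `I` does not have exactly `k` elements. -/
noncomputable def minor {k n : ℕ} (A : Matrix (Fin k) (Fin n) ℝ) (I : Finset (Fin n)) : ℝ :=
  if hc : I.card = k then
    Matrix.det (Matrix.of fun r c : Fin k => A r ((I.orderIsoOfFin hc c : Fin n)))
  else 0

/-- `∏_{l<m} (κ_{i_m} - κ_{i_l})` over the elements `i_1 < ⋯ < i_k` of `I`. -/
noncomputable def pairProd {n : ℕ} (κ : Fin n → ℝ) (I : Finset (Fin n)) : ℝ :=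
  ∏ p ∈ (I ×ˢ I).filter (fun p : Fin n × Fin n => p.1 < p.2), (κ p.2 - κ p.1)

theorem minor_ne_zero_iff_linearIndepOn {k n : ℕ} (A : Matrix (Fin k) (Fin n) ℝ)
    {I : Finset (Fin n)} (hI : I.card = k) :
    minor A I ≠ 0 ↔ LinearIndepOn ℝ A.col (I : Set (Fin n)) := by
  rw [minor, dif_pos hI, ← isUnit_iff_ne_zero, ← Matrix.isUnit_iff_isUnit_det,
    ← Matrix.linearIndependent_cols_iff_isUnit]
  exact linearIndependent_equiv (I.orderIsoOfFin hI).toEquiv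
    (f := fun i : I => A.col (i : Fin n))

/-- The basis exchange property for a finite spanning independent family. -/
theorem LinearIndepOn.exists_exchange {ι K V : Type*} [DecidableEq ι] [Field K]
    [AddCommGroup V] [Module K V] {v : ι → V} {I J : Finset ι} {a : ι}
    (hI : LinearIndepOn K v (I : Set ι)) (hJ : LinearIndepOn K v (J : Set ι))
    (ha : a ∈ I) (haJ : a ∉ J) (hspan : v a ∈ Submodule.span K (v '' (J : Set ι))) :
    ∃ b ∈ J, b ∉ I ∧ LinearIndepOn K v ((insert a (J.erase b) : Finset ι) : Set ι) := by
  obtain ⟨c, hc⟩ := (Submodule.mem_span_image_finset_iff_exists_fun' K).1 hspan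
  by_cases h : ∀ b ∈ J, b ∉ I → c b = 0
  · refine absurd ?_ ((linearIndepOn_iff_notMem_span.1 hI) a ha)
    rw [← hc]
    refine Submodule.sum_mem _ fun j hj => ?_
    by_cases hjI : j ∈ I
    · refine Submodule.smul_mem _ _ (Submodule.subset_span ⟨j, ⟨hjI, ?_⟩, rfl⟩)
      rintro rfl
      exact haJ hj
    · simp [h j hj hjI]
  · push Not at h
    obtain ⟨b, hbJ, hbI, hcb⟩ := h
    refine ⟨b, hbJ, hbI, ?_⟩
    rw [Finset.coe_insert]
    refine (hJ.mono (by simp)).insert fun hmem => ?_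
    refine (linearIndepOn_iff_notMem_span.1 hJ) b hbJ ?_
    rw [← Finset.coe_erase, ← Submodule.smul_mem_iff _ hcb,
      eq_sub_of_add_eq ((Finset.add_sum_erase J (fun j => c j • v j) hbJ).trans hc)]
    exact Submodule.sub_mem _ hmem <| Submodule.sum_mem _ fun j hj =>
      Submodule.smul_mem _ _ (Submodule.subset_span ⟨j, hj, rfl⟩)

theorem exists_minor_exchange {k n : ℕ} (A : Matrix (Fin k) (Fin n) ℝ) {I J : Finset (Fin n)}
    (hIcard : I.card = k) (hJcard : J.card = k) (hI : minor A I ≠ 0) (hJ : minor A J ≠ 0)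
    {a : Fin n} (ha : a ∈ I) (haJ : a ∉ J) :
    ∃ b ∈ J, b ∉ I ∧ (insert a (J.erase b)).card = k ∧ minor A (insert a (J.erase b)) ≠ 0 := by
  rw [minor_ne_zero_iff_linearIndepOn A hIcard] at hI
  rw [minor_ne_zero_iff_linearIndepOn A hJcard] at hJ
  have hspan : A.col a ∈ Submodule.span ℝ (A.col '' (J : Set (Fin n))) := by
    rw [Set.image_eq_range]
    have htop := LinearIndependent.span_eq_top_of_card_eq_finrank' hJ (by simp [hJcard])
    exact htop ▸ Submodule.mem_top
  obtain ⟨b, hbJ, hbI, hind⟩ := hI.exists_exchange hJ ha haJ hspan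
  have hcard : (insert a (J.erase b)).card = k := by
    rw [Finset.card_insert_of_notMem fun h => haJ (Finset.mem_of_mem_erase h),
      Finset.card_erase_add_one hbJ, hJcard]
  exact ⟨b, hbJ, hbI, hcard, (minor_ne_zero_iff_linearIndepOn A hcard).2 hind⟩

/-- The lexicographically maximal basis is the unique basis of maximal weight. -/
theorem sum_lt_sum_of_lex_max {k n : ℕ} {κ : Fin n → ℝ} (hκ : StrictMono κ)
    {A : Matrix (Fin k) (Fin n) ℝ} (hnonneg : ∀ I : Finset (Fin n), 0 ≤ minor A I)
    {Jstar : Finset (Fin n)} (hJcard : Jstar.card = k) (hJpos : 0 < minor A Jstar)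
    (hlexmax : ∀ J : Finset (Fin n), J.card = k → 0 < minor A J → J ≠ Jstar →
      ∃ a ∈ Jstar, a ∉ J ∧ ∀ b ∈ J, b ∉ Jstar → b < a)
    {J : Finset (Fin n)} (hcard : J.card = k) (hpos : 0 < minor A J) (hne : J ≠ Jstar) :
    ∑ i ∈ J, κ i < ∑ i ∈ Jstar, κ i := by
  classical
  have improve : ∀ I : Finset (Fin n), I.card = k → 0 < minor A I → I ≠ Jstar →
      ∃ I' : Finset (Fin n), I'.card = k ∧ 0 < minor A I' ∧ ∑ i ∈ I, κ i < ∑ i ∈ I', κ i := by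
    intro I hIcard hIpos hIne
    obtain ⟨a, ha, haI, hlt⟩ := hlexmax I hIcard hIpos hIne
    obtain ⟨b, hbI, hb, hcard', hne'⟩ :=
      exists_minor_exchange A hJcard hIcard hJpos.ne' hIpos.ne' ha haI
    refine ⟨_, hcard', (hnonneg _).lt_of_ne' hne', ?_⟩
    rw [Finset.sum_insert fun h => haI (Finset.mem_of_mem_erase h), ← Finset.add_sum_erase I κ hbI]
    linarith [hκ (hlt b hbI hb)]
  obtain ⟨B, hB, hmax⟩ := Finset.exists_max_image
    (Finset.univ.filter fun I : Finset (Fin n) => I.card = k ∧ 0 < minor A I)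
    (fun I => ∑ i ∈ I, κ i) ⟨Jstar, by simp [hJcard, hJpos]⟩
  simp only [Finset.mem_filter, Finset.mem_univ, true_and] at hB hmax
  have hBJ : B = Jstar := by
    by_contra hBne
    obtain ⟨I', hI'card, hI'pos, hlt⟩ := improve B hB.1 hB.2 hBne
    exact (hmax I' ⟨hI'card, hI'pos⟩).not_gt hlt
  obtain ⟨I', hI'card, hI'pos, hlt⟩ := improve J hcard hpos hne
  exact hBJ ▸ hlt.trans_le (hmax I' ⟨hI'card, hI'pos⟩)

theorem pairProd_pos {n : ℕ} {κ : Fin n → ℝ} (hκ : StrictMono κ) (I : Finset (Fin n)) :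
    0 < pairProd κ I :=
  Finset.prod_pos fun _ hp => sub_pos.2 (hκ (Finset.mem_filter.1 hp).2)

theorem eventually_mul_exp_lt_mul_exp {s s' c' : ℝ} (hs : s < s') (hc' : 0 < c') (c d d' : ℝ) :
    ∀ᶠ x in Filter.atTop, c * Real.exp (s * x + d) < c' * Real.exp (s' * x + d') := by
  have htendsto : Filter.Tendsto (fun x => c' * Real.exp ((s' - s) * x)) Filter.atTop
      Filter.atTop :=
    (Real.tendsto_exp_atTop.comp
      (Filter.tendsto_id.const_mul_atTop (sub_pos.2 hs))).const_mul_atTop hc'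
  filter_upwards [htendsto.eventually_gt_atTop (c * Real.exp (d - d'))] with x hx
  calc c * Real.exp (s * x + d) = c * Real.exp (d - d') * Real.exp (s * x + d') := by
        rw [mul_assoc, ← Real.exp_add]; ring_nf
    _ < c' * Real.exp ((s' - s) * x) * Real.exp (s * x + d') :=
        mul_lt_mul_of_pos_right hx (Real.exp_pos _)
    _ = c' * Real.exp (s' * x + d') := by
        rw [mul_assoc, ← Real.exp_add]; ring_nf

/-- for generic increasing `κ` (sums over `k`-subsets pairwise distinct) and a
rank-`k` totally nonnegative matrix `A` with `M = {J : Δ_J(A) > 0}`, let `J*` be the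
lexicographically maximal element of `M` (comparing decreasing lists, i.e. for any other
`J ∈ M` the maximum of the symmetric difference lies in `J*`).  Then for any `y, t` and all
sufficiently large `x`, the term `Δ_{J*}(A) E_{J*}(x,y,t)` dominates every other term
`Δ_J(A) E_J(x,y,t)` of the τ-function. -/
theorem lex_max_term_dominates {k n : ℕ} (κ : Fin n → ℝ) (hκ : StrictMono κ)
    (hgen : ∀ I J : Finset (Fin n), I.card = k → J.card = k →
      (∑ i ∈ I, κ i) = (∑ i ∈ J, κ i) → I = J)
    (A : Matrix (Fin k) (Fin n) ℝ) (hrank : A.rank = k)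
    (hnonneg : ∀ I : Finset (Fin n), 0 ≤ minor A I)
    (Jstar : Finset (Fin n)) (hJcard : Jstar.card = k) (hJpos : 0 < minor A Jstar)
    (hlexmax : ∀ J : Finset (Fin n), J.card = k → 0 < minor A J → J ≠ Jstar →
      ∃ a ∈ Jstar, a ∉ J ∧ ∀ b ∈ J, b ∉ Jstar → b < a) :
    ∀ y t : ℝ, ∃ x₀ : ℝ, ∀ x : ℝ, x₀ < x →
      ∀ J : Finset (Fin n), J.card = k → 0 < minor A J → J ≠ Jstar →
        minor A J *
            (pairProd κ J *
              Real.exp (∑ i ∈ J, (κ i * x + κ i ^ 2 * y + κ i ^ 3 * t))) <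
          minor A Jstar *
            (pairProd κ Jstar *
              Real.exp (∑ i ∈ Jstar, (κ i * x + κ i ^ 2 * y + κ i ^ 3 * t))) := by
  intro y t
  suffices h : ∀ᶠ x in Filter.atTop, ∀ J : Finset (Fin n), J.card = k → 0 < minor A J →
      J ≠ Jstar →
        minor A J *
            (pairProd κ J *
              Real.exp (∑ i ∈ J, (κ i * x + κ i ^ 2 * y + κ i ^ 3 * t))) <
          minor A Jstar *
            (pairProd κ Jstar *
              Real.exp (∑ i ∈ Jstar, (κ i * x + κ i ^ 2 * y + κ i ^ 3 * t))) by
    obtain ⟨x₀, hx₀⟩ := Filter.eventually_atTop.1 h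
    exact ⟨x₀, fun x hx => hx₀ x hx.le⟩
  refine Filter.eventually_all.2 fun J => ?_
  by_cases hJ : J.card = k ∧ 0 < minor A J ∧ J ≠ Jstar
  · obtain ⟨hcard, hpos, hne⟩ := hJ
    filter_upwards [eventually_mul_exp_lt_mul_exp
      (sum_lt_sum_of_lex_max hκ hnonneg hJcard hJpos hlexmax hcard hpos hne)
      (mul_pos hJpos (pairProd_pos hκ Jstar)) (minor A J * pairProd κ J)
      (∑ i ∈ J, (κ i ^ 2 * y + κ i ^ 3 * t)) (∑ i ∈ Jstar, (κ i ^ 2 * y + κ i ^ 3 * t))] with x hx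
    intro _ _ _
    simpa only [Finset.sum_mul, ← Finset.sum_add_distrib, mul_assoc, ← add_assoc] using hx
  · exact Filter.Eventually.of_forall fun x h₁ h₂ h₃ => absurd ⟨h₁, h₂, h₃⟩ hJ
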